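/- arXiv:1705.09911 — 2 statements merged into one kernel-verified Lean document; each statement's English description precedes it below -/
import Mathlib

section
/- Let n ≥ 1 and let B be a nonnegative irreducible elasticity tensor, i.e. a nonnegative elasticity tensor such that all the n×n matrices B_x^{(k,k)} := (b_{ijkk})_{i,j} for k ∈ {1,…,n} and B_y^{(i,i)} := (b_{iikl})_{k,l} for i ∈ {1,…,n} are irreducible. Then there exist vectors x, y ∈ ℝ^n with all components strictly positive and xᵀx = yᵀy = 1 such that B x y² = ρ_M(B) x and B x² y = ρ_M(B) y; in particular, ρ_M(B) = max{ B x² y² : x, y ∈ ℝ^n, x > 0, y > 0, xᵀx = yᵀy = 1 }. -/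
open Finset

noncomputable section

/-- Symmetry condition of an elasticity tensor: `a_{ijkl} = a_{jikl} = a_{ijlk}`. -/
def ElastSym {n : ℕ} (A : Fin n → Fin n → Fin n → Fin n → ℝ) : Prop :=
  ∀ i j k l, A i j k l = A j i k l ∧ A i j k l = A i j l k

/-- The scalar `A x² y² = ∑ a_{ijkl} x_i x_j y_k y_l`. -/
def tQuad {n : ℕ} (A : Fin n → Fin n → Fin n → Fin n → ℝ) (x y : Fin n → ℝ) : ℝ :=
  ∑ i, ∑ j, ∑ k, ∑ l, A i j k l * x i * x j * y k * y l

/-- The vector `(A x y²)_i = ∑ a_{ijkl} x_j y_k y_l`. -/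
def tAxyy {n : ℕ} (A : Fin n → Fin n → Fin n → Fin n → ℝ) (x y : Fin n → ℝ) : Fin n → ℝ :=
  fun i => ∑ j, ∑ k, ∑ l, A i j k l * x j * y k * y l

/-- The vector `(A x² y)_l = ∑ a_{ijkl} x_i x_j y_k`. -/
def tAxxy {n : ℕ} (A : Fin n → Fin n → Fin n → Fin n → ℝ) (x y : Fin n → ℝ) : Fin n → ℝ :=
  fun l => ∑ i, ∑ j, ∑ k, A i j k l * x i * x j * y k

/-- The matrix `(A x²)_{kl} = ∑ a_{ijkl} x_i x_j`. -/
def matAx2 {n : ℕ} (A : Fin n → Fin n → Fin n → Fin n → ℝ) (x : Fin n → ℝ) :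
    Matrix (Fin n) (Fin n) ℝ :=
  Matrix.of fun k l => ∑ i, ∑ j, A i j k l * x i * x j

/-- The matrix `(A y²)_{ij} = ∑ a_{ijkl} y_k y_l`. -/
def matAy2 {n : ℕ} (A : Fin n → Fin n → Fin n → Fin n → ℝ) (y : Fin n → ℝ) :
    Matrix (Fin n) (Fin n) ℝ :=
  Matrix.of fun i j => ∑ k, ∑ l, A i j k l * y k * y l

/-- The identity tensor `e_{ijkl} = 1` iff `i = j` and `k = l`. -/
def idT (n : ℕ) : Fin n → Fin n → Fin n → Fin n → ℝ :=
  fun i j k l => if i = j ∧ k = l then 1 else 0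

/-- `xᵀ x = 1`. -/
def unitVec {n : ℕ} (x : Fin n → ℝ) : Prop := ∑ i, x i * x i = 1

/-- `(λ, x, y)` is an M-eigenpair of `A`. -/
def IsMEig {n : ℕ} (A : Fin n → Fin n → Fin n → Fin n → ℝ) (lam : ℝ) (x y : Fin n → ℝ) :
    Prop :=
  (∀ i, tAxyy A x y i = lam * x i) ∧ (∀ l, tAxxy A x y l = lam * y l) ∧
    unitVec x ∧ unitVec y

/-- M-positive definiteness (the strong ellipticity condition). -/
def MPD {n : ℕ} (A : Fin n → Fin n → Fin n → Fin n → ℝ) : Prop :=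
  ∀ x y : Fin n → ℝ, x ≠ 0 → y ≠ 0 → 0 < tQuad A x y

/-- M-positive semidefiniteness. -/
def MPSD {n : ℕ} (A : Fin n → Fin n → Fin n → Fin n → ℝ) : Prop :=
  ∀ x y : Fin n → ℝ, 0 ≤ tQuad A x y

/-- All entries are nonnegative. -/
def NonnegT {n : ℕ} (A : Fin n → Fin n → Fin n → Fin n → ℝ) : Prop :=
  ∀ i j k l, 0 ≤ A i j k l

/-- The M-spectral radius of a nonnegative elasticity tensor:
`sup { B x² y² : xᵀx = yᵀy = 1 }`. -/
def rhoM {n : ℕ} (B : Fin n → Fin n → Fin n → Fin n → ℝ) : ℝ :=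
  sSup { r : ℝ | ∃ x y : Fin n → ℝ, unitVec x ∧ unitVec y ∧ r = tQuad B x y }

/-- An elasticity Z-tensor: all off-diagonal entries nonpositive. -/
def ZTensor {n : ℕ} (A : Fin n → Fin n → Fin n → Fin n → ℝ) : Prop :=
  ∀ i j k l, ¬(i = j ∧ k = l) → A i j k l ≤ 0

/-- A nonsingular elasticity M-tensor: `A = s E - B` with `B` nonnegative and `s > ρ_M(B)`. -/
def NonsingMT {n : ℕ} (A : Fin n → Fin n → Fin n → Fin n → ℝ) : Prop :=
  ∃ (s : ℝ) (B : Fin n → Fin n → Fin n → Fin n → ℝ),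
    ElastSym B ∧ NonnegT B ∧ (∀ i j k l, A i j k l = s * idT n i j k l - B i j k l) ∧
      rhoM B < s

/-- An elasticity M-tensor: `A = s E - B` with `B` nonnegative and `s ≥ ρ_M(B)`. -/
def ElastMT {n : ℕ} (A : Fin n → Fin n → Fin n → Fin n → ℝ) : Prop :=
  ∃ (s : ℝ) (B : Fin n → Fin n → Fin n → Fin n → ℝ),
    ElastSym B ∧ NonnegT B ∧ (∀ i j k l, A i j k l = s * idT n i j k l - B i j k l) ∧
      rhoM B ≤ s

/-- Irreducibility of a (nonnegative) square matrix. -/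
def MatIrred {n : ℕ} (M : Matrix (Fin n) (Fin n) ℝ) : Prop :=
  ∀ S : Finset (Fin n), S.Nonempty → S ≠ Finset.univ → ∃ k ∈ S, ∃ l ∉ S, M k l ≠ 0

/-- Strict diagonal dominance. -/
def SDD {n : ℕ} (M : Matrix (Fin n) (Fin n) ℝ) : Prop :=
  ∀ i, ∑ j ∈ Finset.univ.erase i, |M i j| < |M i i|

open Matrix in
/-- A nonnegative unit maximizer of the quadratic form of a symmetric nonnegative irreducible matrix
on the unit sphere is a strictly positive eigenvector. -/
lemma pos_eigenvector_of_isMax {n : ℕ} {M : Matrix (Fin n) (Fin n) ℝ} {lam : ℝ}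
    {x : Fin n → ℝ} (hsymm : M.IsSymm) (hM : ∀ i j, 0 ≤ M i j) (hirr : MatIrred M)
    (hx0 : ∀ i, 0 ≤ x i) (hx : unitVec x) (hval : x ⬝ᵥ M *ᵥ x = lam)
    (hmax : ∀ z, unitVec z → z ⬝ᵥ M *ᵥ z ≤ lam) :
    M *ᵥ x = lam • x ∧ ∀ i, 0 < x i := by
  have hle (z : Fin n → ℝ) : z ⬝ᵥ M *ᵥ z ≤ lam * (z ⬝ᵥ z) := by
    rcases eq_or_ne z 0 with rfl | hz
    · simp
    have hpos : 0 < z ⬝ᵥ z :=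
      lt_of_le_of_ne (Finset.sum_nonneg fun i _ => mul_self_nonneg _)
        (Ne.symm (mt dotProduct_self_eq_zero.1 hz))
    set c := (√(z ⬝ᵥ z))⁻¹
    have hc : c * c * (z ⬝ᵥ z) = 1 := by
      rw [← mul_inv, Real.mul_self_sqrt hpos.le, inv_mul_cancel₀ hpos.ne']
    have h := hmax (c • z) (by
      change (c • z) ⬝ᵥ (c • z) = 1
      simpa [← mul_assoc] using hc)
    simp only [mulVec_smul, dotProduct_smul, smul_dotProduct, smul_eq_mul] at h
    calc z ⬝ᵥ M *ᵥ z = (c * c * (z ⬝ᵥ z)) * (z ⬝ᵥ M *ᵥ z) := by rw [hc, one_mul]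
      _ = (c * (c * (z ⬝ᵥ M *ᵥ z))) * (z ⬝ᵥ z) := by ring
      _ ≤ lam * (z ⬝ᵥ z) := by gcongr
  have hpsd : (lam • (1 : Matrix (Fin n) (Fin n) ℝ) - M).PosSemidef := by
    refine PosSemidef.of_dotProduct_mulVec_nonneg ?_ fun z => ?_
    · ext i j
      simp [Matrix.one_apply, eq_comm, hsymm.apply i j]
    · simpa [sub_mulVec, smul_mulVec, dotProduct_sub] using hle z
  have hxx : x ⬝ᵥ x = 1 := hx
  have heig : M *ᵥ x = lam • x := by
    have h := (hpsd.dotProduct_mulVec_zero_iff x).1 (by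
      simp [sub_mulVec, smul_mulVec, dotProduct_sub, hval, hxx])
    rw [sub_mulVec, smul_mulVec, one_mulVec, sub_eq_zero] at h
    exact h.symm
  refine ⟨heig, ?_⟩
  by_contra! hneg
  obtain ⟨i₀, hi₀⟩ := hneg
  obtain ⟨k, hk, l, hl, hkl⟩ := hirr (univ.filter fun i => x i = 0)
    ⟨i₀, by simpa using le_antisymm hi₀ (hx0 i₀)⟩ (by
      intro h
      have hzero : x = 0 := funext fun i => by simpa using Finset.ext_iff.1 h i
      simp [hzero] at hxx)
  simp only [mem_filter, mem_univ, true_and] at hk hl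
  have hsum : ∑ j, M k j * x j = 0 := by
    simpa [hk, mulVec, dotProduct] using congrFun heig k
  have := (Finset.sum_eq_zero_iff_of_nonneg fun j _ => mul_nonneg (hM k j) (hx0 j)).1 hsum l
    (mem_univ l)
  exact (mul_ne_zero hkl hl) this

lemma unitVec.exists_ne_zero {n : ℕ} {x : Fin n → ℝ} (hx : unitVec x) : ∃ i, x i ≠ 0 := by
  by_contra! h
  simp [unitVec, h] at hx

open Matrix in
lemma tQuad_eq_matAy2 {n : ℕ} (A : Fin n → Fin n → Fin n → Fin n → ℝ) (x y : Fin n → ℝ) :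
    tQuad A x y = x ⬝ᵥ matAy2 A y *ᵥ x := by
  simp only [tQuad, matAy2, dotProduct, mulVec, of_apply, Finset.mul_sum, Finset.sum_mul]
  refine Finset.sum_congr rfl fun i _ => Finset.sum_congr rfl fun j _ =>
    Finset.sum_congr rfl fun k _ => Finset.sum_congr rfl fun l _ => by ring

open Matrix in
lemma tAxyy_eq_matAy2 {n : ℕ} (A : Fin n → Fin n → Fin n → Fin n → ℝ) (x y : Fin n → ℝ) :
    tAxyy A x y = matAy2 A y *ᵥ x := by
  ext i
  simp only [tAxyy, matAy2, dotProduct, mulVec, of_apply, Finset.sum_mul]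
  refine Finset.sum_congr rfl fun j _ => Finset.sum_congr rfl fun k _ =>
    Finset.sum_congr rfl fun l _ => by ring

/-- The tensor with the two index pairs exchanged. -/
def swapT {n : ℕ} (A : Fin n → Fin n → Fin n → Fin n → ℝ) : Fin n → Fin n → Fin n → Fin n → ℝ :=
  fun i j k l => A k l i j

lemma tQuad_swapT {n : ℕ} (A : Fin n → Fin n → Fin n → Fin n → ℝ) (x y : Fin n → ℝ) :
    tQuad (swapT A) y x = tQuad A x y := by
  have hpair (f : Fin n → Fin n → Fin n → Fin n → ℝ) :
      ∑ i, ∑ j, ∑ k, ∑ l, f i j k l = ∑ p : Fin n × Fin n, ∑ q : Fin n × Fin n,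
        f p.1 p.2 q.1 q.2 := by
    simp only [Fintype.sum_prod_type]
  simp only [tQuad, hpair, swapT]
  rw [Finset.sum_comm]
  refine Finset.sum_congr rfl fun p _ => Finset.sum_congr rfl fun q _ => by ring

lemma tAxyy_swapT {n : ℕ} {A : Fin n → Fin n → Fin n → Fin n → ℝ} (hA : ElastSym A)
    (x y : Fin n → ℝ) : tAxyy (swapT A) y x = tAxxy A x y := by
  ext l
  simp only [tAxyy, tAxxy, swapT]
  rw [Finset.sum_comm]
  refine Finset.sum_congr rfl fun i _ => ?_
  rw [Finset.sum_comm]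
  refine Finset.sum_congr rfl fun j _ => Finset.sum_congr rfl fun k _ => ?_
  rw [(hA i j l k).2]
  ring

lemma elastSym_swapT {n : ℕ} {A : Fin n → Fin n → Fin n → Fin n → ℝ} (hA : ElastSym A) :
    ElastSym (swapT A) :=
  fun i j k l => ⟨(hA k l i j).2, (hA k l i j).1⟩

/-- If `x ≥ 0` maximizes `A x² y²` among unit vectors for a fixed unit `y ≥ 0`, then it is a
strictly positive solution of `A x y² = (A x² y²) x`. -/
lemma pos_tAxyy_eq_of_isMax {n : ℕ} {A : Fin n → Fin n → Fin n → Fin n → ℝ} (hA : ElastSym A)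
    (hnn : NonnegT A) (hirr : ∀ k, MatIrred (Matrix.of fun i j => A i j k k))
    {x y : Fin n → ℝ} (hx0 : ∀ i, 0 ≤ x i) (hy0 : ∀ i, 0 ≤ y i) (hx : unitVec x)
    (hy : unitVec y) (hmax : ∀ z, unitVec z → tQuad A z y ≤ tQuad A x y) :
    (∀ i, tAxyy A x y i = tQuad A x y * x i) ∧ ∀ i, 0 < x i := by
  have hterm (i j k l : Fin n) : 0 ≤ A i j k l * y k * y l :=
    mul_nonneg (mul_nonneg (hnn i j k l) (hy0 k)) (hy0 l)
  have hirr' : MatIrred (matAy2 A y) := by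
    obtain ⟨m, hm⟩ := hy.exists_ne_zero
    intro S hS hS'
    obtain ⟨k, hk, l, hl, hkl⟩ := hirr m S hS hS'
    refine ⟨k, hk, l, hl, fun h => ?_⟩
    rw [matAy2, Matrix.of_apply] at h
    have h1 := (Finset.sum_eq_zero_iff_of_nonneg fun p _ =>
      Finset.sum_nonneg fun q _ => hterm k l p q).1 h m (mem_univ m)
    have h2 := (Finset.sum_eq_zero_iff_of_nonneg fun q _ => hterm k l m q).1 h1 m (mem_univ m)
    exact mul_ne_zero (mul_ne_zero hkl hm) hm h2
  have h := pos_eigenvector_of_isMax (M := matAy2 A y) (x := x) (lam := tQuad A x y)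
    (Matrix.IsSymm.ext fun i j => by simp only [matAy2, Matrix.of_apply, (hA i j _ _).1])
    (fun i j => by
      rw [matAy2, Matrix.of_apply]
      exact Finset.sum_nonneg fun k _ => Finset.sum_nonneg fun l _ => hterm i j k l)
    hirr' hx0 hx (tQuad_eq_matAy2 A x y).symm
    (fun z hz => tQuad_eq_matAy2 A z y ▸ hmax z hz)
  exact ⟨fun i => by rw [tAxyy_eq_matAy2, h.1]; rfl, h.2⟩

lemma tQuad_le_tQuad_abs {n : ℕ} {A : Fin n → Fin n → Fin n → Fin n → ℝ} (hnn : NonnegT A)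
    (x y : Fin n → ℝ) : tQuad A x y ≤ tQuad A (fun i => |x i|) fun i => |y i| := by
  refine Finset.sum_le_sum fun i _ => Finset.sum_le_sum fun j _ => Finset.sum_le_sum fun k _ =>
    Finset.sum_le_sum fun l _ => (le_abs_self _).trans_eq ?_
  simp only [abs_mul, abs_of_nonneg (hnn i j k l)]

lemma unitVec.abs {n : ℕ} {x : Fin n → ℝ} (hx : unitVec x) : unitVec fun i => |x i| := by
  simpa only [unitVec, abs_mul_abs_self] using hx

lemma isCompact_setOf_unitVec (n : ℕ) : IsCompact {x : Fin n → ℝ | unitVec x} := by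
  refine Metric.isCompact_of_isClosed_isBounded
    (isClosed_eq (by fun_prop) continuous_const) ?_
  refine Metric.isBounded_closedBall (x := (0 : Fin n → ℝ)) (r := 1) |>.subset fun x hx => ?_
  rw [mem_closedBall_zero_iff, pi_norm_le_iff_of_nonneg zero_le_one]
  intro i
  have hi : x i * x i ≤ 1 := (Finset.single_le_sum (f := fun i => x i * x i)
    (fun j _ => mul_self_nonneg _) (mem_univ i)).trans_eq hx
  exact abs_le_one_iff_mul_self_le_one.2 hi

lemma exists_nonneg_isMax_tQuad {n : ℕ} (hn : 1 ≤ n) {A : Fin n → Fin n → Fin n → Fin n → ℝ}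
    (hnn : NonnegT A) : ∃ x y : Fin n → ℝ, (∀ i, 0 ≤ x i) ∧ (∀ i, 0 ≤ y i) ∧ unitVec x ∧
      unitVec y ∧ ∀ u v, unitVec u → unitVec v → tQuad A u v ≤ tQuad A x y := by
  have he : unitVec (Pi.single (⟨0, hn⟩ : Fin n) (1 : ℝ)) := by
    simp [unitVec, Pi.single_apply]
  obtain ⟨⟨x, y⟩, ⟨hx, hy⟩, hmax⟩ :=
    ((isCompact_setOf_unitVec n).prod (isCompact_setOf_unitVec n)).exists_isMaxOn
      (f := fun p => tQuad A p.1 p.2) ⟨(_, _), he, he⟩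
      (by unfold tQuad; fun_prop)
  exact ⟨_, _, fun i => abs_nonneg (x i), fun i => abs_nonneg (y i), unitVec.abs hx,
    unitVec.abs hy, fun u v hu hv =>
      (hmax (show (u, v) ∈ _ from ⟨hu, hv⟩)).trans (tQuad_le_tQuad_abs hnn x y)⟩

/-- a nonnegative irreducible elasticity tensor has a pair of strictly
positive unit M-eigenvectors corresponding to its M-spectral radius, which is attained
there. -/
theorem stmt_10 {n : ℕ} (hn : 1 ≤ n) (B : Fin n → Fin n → Fin n → Fin n → ℝ)
    (hB : ElastSym B) (hnn : NonnegT B)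
    (hirrx : ∀ k : Fin n, MatIrred (Matrix.of fun i j => B i j k k))
    (hirry : ∀ i : Fin n, MatIrred (Matrix.of fun k l => B i i k l)) :
    ∃ x y : Fin n → ℝ, (∀ i, 0 < x i) ∧ (∀ i, 0 < y i) ∧ unitVec x ∧ unitVec y ∧
      (∀ i, tAxyy B x y i = rhoM B * x i) ∧ (∀ l, tAxxy B x y l = rhoM B * y l) ∧
      tQuad B x y = rhoM B := by
  obtain ⟨x, y, hx0, hy0, hx, hy, hmax⟩ := exists_nonneg_isMax_tQuad hn hnn
  have hrho : rhoM B = tQuad B x y :=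
    IsGreatest.csSup_eq ⟨⟨x, y, hx, hy, rfl⟩, by
      rintro _ ⟨u, v, hu, hv, rfl⟩
      exact hmax u v hu hv⟩
  obtain ⟨hxeig, hxpos⟩ := pos_tAxyy_eq_of_isMax hB hnn hirrx hx0 hy0 hx hy
    fun z hz => hmax z y hz hy
  obtain ⟨hyeig, hypos⟩ := pos_tAxyy_eq_of_isMax (elastSym_swapT hB)
    (fun i j k l => hnn k l i j) hirry hy0 hx0 hy hx
    fun z hz => by simpa only [tQuad_swapT] using hmax x z hx hz
  simp only [tAxyy_swapT hB, tQuad_swapT] at hyeig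
  exact ⟨x, y, hxpos, hypos, hx, hy, hrho ▸ hxeig, hrho ▸ hyeig, hrho.symm⟩
end
end

section
/- Let n ≥ 1 and let A be an elasticity tensor. Then A is an elasticity M-tensor if and only if A + tE is a nonsingular elasticity M-tensor for every t > 0. -/
open Finset

noncomputable section

lemma unitVec.abs_le_one {n : ℕ} {x : Fin n → ℝ} (hx : unitVec x) (i : Fin n) : |x i| ≤ 1 := by
  have h : x i * x i ≤ ∑ j, x j * x j :=
    Finset.single_le_sum (f := fun j => x j * x j) (fun j _ => mul_self_nonneg (x j))
      (Finset.mem_univ i)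
  rw [unitVec] at hx
  rw [abs_le]
  constructor <;> nlinarith

lemma exists_unitVec {n : ℕ} (hn : 1 ≤ n) : ∃ x : Fin n → ℝ, unitVec x :=
  ⟨Pi.single ⟨0, hn⟩ 1, by simp [unitVec, Pi.single_apply]⟩

lemma tQuad_idT {n : ℕ} {x y : Fin n → ℝ} (hx : unitVec x) (hy : unitVec y) :
    tQuad (idT n) x y = 1 := by
  have h : tQuad (idT n) x y = (∑ i, x i * x i) * ∑ k, y k * y k := by
    simp only [tQuad, idT, ite_and, Finset.sum_mul_sum]
    refine Finset.sum_congr rfl fun i _ => ?_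
    rw [Finset.sum_eq_single i (fun j _ hj => by simp [hj.symm]) (by simp)]
    refine Finset.sum_congr rfl fun k _ => ?_
    rw [Finset.sum_eq_single k (fun l _ hl => by simp [hl.symm]) (by simp)]
    simp only [if_true]
    ring
  rw [h, hx, hy, one_mul]

lemma tQuad_smul_idT_sub {n : ℕ} (s : ℝ) (B : Fin n → Fin n → Fin n → Fin n → ℝ)
    {x y : Fin n → ℝ} (hx : unitVec x) (hy : unitVec y) :
    tQuad (fun i j k l => s * idT n i j k l - B i j k l) x y = s - tQuad B x y := by
  have hs : s = s * tQuad (idT n) x y := by rw [tQuad_idT hx hy, mul_one]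
  conv_rhs => rw [hs]
  simp only [tQuad, Finset.mul_sum, ← Finset.sum_sub_distrib]
  refine Finset.sum_congr rfl fun i _ => Finset.sum_congr rfl fun j _ =>
    Finset.sum_congr rfl fun k _ => Finset.sum_congr rfl fun l _ => ?_
  ring

lemma tQuad_le_rhoM {n : ℕ} (B : Fin n → Fin n → Fin n → Fin n → ℝ)
    {x y : Fin n → ℝ} (hx : unitVec x) (hy : unitVec y) : tQuad B x y ≤ rhoM B := by
  refine le_csSup ⟨∑ i, ∑ j, ∑ k, ∑ l, |B i j k l|, ?_⟩ ⟨x, y, hx, hy, rfl⟩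
  rintro r ⟨u, v, hu, hv, rfl⟩
  refine Finset.sum_le_sum fun i _ => Finset.sum_le_sum fun j _ =>
    Finset.sum_le_sum fun k _ => Finset.sum_le_sum fun l _ => (le_abs_self _).trans ?_
  simp only [abs_mul]
  calc |B i j k l| * |u i| * |u j| * |v k| * |v l| ≤ |B i j k l| * 1 * 1 * 1 * 1 := by
        gcongr
        exacts [hu.abs_le_one i, hu.abs_le_one j, hv.abs_le_one k, hv.abs_le_one l]
    _ = |B i j k l| := by ring

/-- `A` is an elasticity M-tensor iff `A + t E` is a nonsingular
elasticity M-tensor for every `t > 0`. -/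
theorem stmt_12 {n : ℕ} (hn : 1 ≤ n) (A : Fin n → Fin n → Fin n → Fin n → ℝ)
    (hA : ElastSym A) :
    ElastMT A ↔ ∀ t : ℝ, 0 < t →
      NonsingMT (fun i j k l => A i j k l + t * idT n i j k l) := by
  constructor
  · rintro ⟨s, B, hB, hB0, hAB, hs⟩ t ht
    refine ⟨s + t, B, hB, hB0, fun i j k l => ?_, by linarith⟩
    linear_combination hAB i j k l
  · intro h
    have hpos : ∀ x y : Fin n → ℝ, unitVec x → unitVec y → 0 ≤ tQuad A x y := by
      intro x y hx hy
      refine le_of_forall_pos_le_add fun t ht => ?_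
      obtain ⟨s, B, -, -, hAB, hs⟩ := h t ht
      have hA' : A = fun i j k l => (s - t) * idT n i j k l - B i j k l := by
        funext i j k l
        linear_combination hAB i j k l
      rw [hA', tQuad_smul_idT_sub _ _ hx hy]
      linarith [tQuad_le_rhoM B hx hy]
    obtain ⟨s, B, hB, hB0, hAB, -⟩ := h 1 one_pos
    have hA' : ∀ i j k l, A i j k l = (s - 1) * idT n i j k l - B i j k l := fun i j k l => by
      linear_combination hAB i j k l
    refine ⟨s - 1, B, hB, hB0, hA', ?_⟩
    obtain ⟨e, he⟩ := exists_unitVec hn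
    refine csSup_le ⟨_, e, e, he, he, rfl⟩ ?_
    rintro r ⟨x, y, hx, hy, rfl⟩
    have hq := hpos x y hx hy
    rw [show A = fun i j k l => (s - 1) * idT n i j k l - B i j k l by
      funext i j k l; exact hA' i j k l, tQuad_smul_idT_sub _ _ hx hy] at hq
    linarith
end
end
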